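/- There exist disjoint Bernstein sets A, B ⊆ ℝ such that A ∪ B is an algebraically independent Bernstein set. -/

import Mathlib

noncomputable section

open Set Cardinal

/-- A Cantor set: a nonempty compact subset of ℝ that is totally disconnected
and dense in itself (no isolated points). -/
def IsCantorSet (C : Set ℝ) : Prop :=
  C.Nonempty ∧ IsCompact C ∧ IsTotallyDisconnected C ∧ Preperfect C

/-- A Bernstein set: neither it nor its complement contains a Cantor set. -/
def IsBernsteinSet (B : Set ℝ) : Prop :=
  (¬ ∃ C ⊆ B, IsCantorSet C) ∧ (¬ ∃ C ⊆ Bᶜ, IsCantorSet C)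

/-- A set `S ⊆ ℝ` is algebraically independent (over ℚ). -/
def AlgIndepSet (S : Set ℝ) : Prop := AlgebraicIndependent ℚ ((↑) : S → ℝ)

theorem IsCantorSet.continuum_le_mk {C : Set ℝ} (hC : IsCantorSet C) : 𝔠 ≤ #C := by
  obtain ⟨hne, hcomp, -, hperf⟩ := hC
  obtain ⟨f, hf, -, hinj⟩ := Perfect.exists_nat_bool_injection ⟨hcomp.isClosed, hperf⟩ hne
  calc 𝔠 = #(ℕ → Bool) := by simp
    _ ≤ #C := mk_le_of_injective (f := fun x ↦ (⟨f x, hf ⟨x, rfl⟩⟩ : C))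
      fun x y h ↦ hinj (congrArg Subtype.val h)

theorem mk_setOf_isCantorSet_le : #{C : Set ℝ | IsCantorSet C} ≤ 𝔠 := by
  have hgen := (TopologicalSpace.isBasis_countableBasis ℝ).borel_eq_generateFrom
  have hle := MeasurableSpace.cardinal_measurableSet_le_continuum
    ((TopologicalSpace.countable_countableBasis ℝ).le_aleph0.trans aleph0_le_continuum)
  rw [← hgen] at hle
  refine (mk_le_mk_of_subset fun C hC ↦ ?_).trans hle
  have := hC.2.1.isClosed.measurableSet
  rwa [BorelSpace.measurable_eq (α := ℝ)] at this

theorem exists_mem_transcendental_adjoin {P S : Set ℝ} (hP : 𝔠 ≤ #P) (hS : #S < 𝔠) :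
    ∃ x ∈ P, Transcendental (Algebra.adjoin ℚ S) x := by
  by_contra! h
  have hsub : P ⊆ {x : ℝ | IsAlgebraic (Algebra.adjoin ℚ S) x} := fun x hx ↦ by
    simpa [Transcendental] using h x hx
  have hlt : max #(Algebra.adjoin ℚ S) ℵ₀ < 𝔠 := by
    refine max_lt ((Algebra.cardinalMk_adjoin_le ℚ S).trans_lt ?_) aleph0_lt_continuum
    simp [hS, aleph0_lt_continuum]
  exact ((mk_le_mk_of_subset hsub).trans (Algebraic.cardinalMk_le_max _ ℝ)).not_gt
    (hlt.trans_le hP)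

theorem algebraicIndependent_of_transcendental_adjoin_image_Iio {R A ι : Type*} [CommRing R]
    [CommRing A] [NoZeroDivisors A] [Algebra R A] [LinearOrder ι] {x : ι → A}
    (hinj : Function.Injective (algebraMap R A))
    (hx : ∀ i, Transcendental (Algebra.adjoin R (x '' Iio i)) (x i)) :
    AlgebraicIndependent R x := by
  refine algebraicIndependent_of_finite_type fun t ht ↦ ?_
  lift t to Finset ι using ht
  induction t using Finset.induction_on_max with
  | empty =>
    rw [Finset.coe_empty]
    exact algebraicIndependent_empty_type_iff.mpr hinj
  | insert a s hs ih =>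
    rw [Finset.coe_insert]
    exact AlgebraicIndepOn.insert ih <| (hx a).of_tower_top_of_subalgebra_le <|
      Algebra.adjoin_mono <| image_mono fun i hi ↦ hs i hi

theorem exists_algebraicIndependent_forall_mem {ι : Type} (hι : #ι ≤ 𝔠) {P : ι → Set ℝ}
    (hP : ∀ i, 𝔠 ≤ #(P i)) : ∃ x : ι → ℝ, (∀ i, x i ∈ P i) ∧ AlgebraicIndependent ℚ x := by
  obtain ⟨_, _, hr⟩ := exists_ord_eq_type_lt ι
  have hIio (i : ι) : #(Iio i) < 𝔠 := (mk_Iio_lt i hr).trans_le hι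
  have step (i : ι) (y : Iio i → ℝ) :
      ∃ z ∈ P i, Transcendental (Algebra.adjoin ℚ (range y)) z :=
    exists_mem_transcendental_adjoin (hP i) (mk_range_le.trans_lt (hIio i))
  choose next hmem htrans using step
  let x : ι → ℝ := wellFounded_lt.fix fun i ih ↦ next i fun j ↦ ih j j.2
  have hx (i : ι) : x i = next i fun j ↦ x j := wellFounded_lt.fix_eq _ i
  refine ⟨x, fun i ↦ hx i ▸ hmem _ _, ?_⟩
  refine algebraicIndependent_of_transcendental_adjoin_image_Iio
    (algebraMap ℚ ℝ).injective fun i ↦ ?_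
  rw [image_eq_range, hx i]
  exact htrans i _

theorem isBernsteinSet_of_forall_inter_nonempty {B : Set ℝ}
    (h : ∀ C, IsCantorSet C → (C ∩ B).Nonempty ∧ (C ∩ Bᶜ).Nonempty) : IsBernsteinSet B := by
  constructor
  · rintro ⟨C, hCB, hC⟩
    obtain ⟨x, hxC, hxB⟩ := (h C hC).2
    exact hxB (hCB hxC)
  · rintro ⟨C, hCB, hC⟩
    obtain ⟨x, hxC, hxB⟩ := (h C hC).1
    exact hCB hxC hxB

/-- There exist disjoint Bernstein sets A, B such that A ∪ B is an
algebraically independent Bernstein set. -/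
theorem exists_disjoint_bernstein_algIndep_union :
    ∃ A B : Set ℝ, Disjoint A B ∧ IsBernsteinSet A ∧ IsBernsteinSet B ∧
      AlgIndepSet (A ∪ B) ∧ IsBernsteinSet (A ∪ B) := by
  have hι : #({C : Set ℝ | IsCantorSet C} × Fin 3) ≤ 𝔠 := by
    rw [mk_prod, lift_id, lift_id, mk_fin]
    exact (mul_le_mul_left mk_setOf_isCantorSet_le _).trans
      (continuum_mul_nat (by norm_num)).le
  obtain ⟨x, hmem, hind⟩ := exists_algebraicIndependent_forall_mem hι
    (P := fun i ↦ i.1) fun i ↦ i.1.2.continuum_le_mk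
  have hinj := hind.injective
  have notMem {i j : Fin 3} (hij : i ≠ j) (C : {C : Set ℝ | IsCantorSet C}) :
      x (C, i) ∉ range fun D ↦ x (D, j) := by
    rintro ⟨D, hD⟩
    exact hij (congrArg Prod.snd (hinj hD)).symm
  refine ⟨range fun C ↦ x (C, 0), range fun C ↦ x (C, 1), ?_, ?_, ?_, ?_, ?_⟩
  · rw [disjoint_left]
    rintro _ ⟨C, rfl⟩
    exact notMem (by decide) C
  · exact isBernsteinSet_of_forall_inter_nonempty fun C hC ↦
      ⟨⟨x (⟨C, hC⟩, 0), hmem (⟨C, hC⟩, 0), ⟨C, hC⟩, rfl⟩,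
        ⟨x (⟨C, hC⟩, 2), hmem (⟨C, hC⟩, 2), notMem (by decide) _⟩⟩
  · exact isBernsteinSet_of_forall_inter_nonempty fun C hC ↦
      ⟨⟨x (⟨C, hC⟩, 1), hmem (⟨C, hC⟩, 1), ⟨C, hC⟩, rfl⟩,
        ⟨x (⟨C, hC⟩, 2), hmem (⟨C, hC⟩, 2), notMem (by decide) _⟩⟩
  · refine hind.coe_range.mono (union_subset ?_ ?_) <;> rintro _ ⟨C, rfl⟩ <;> exact ⟨_, rfl⟩
  · exact isBernsteinSet_of_forall_inter_nonempty fun C hC ↦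
      ⟨⟨x (⟨C, hC⟩, 0), hmem (⟨C, hC⟩, 0), Or.inl ⟨⟨C, hC⟩, rfl⟩⟩,
        ⟨x (⟨C, hC⟩, 2), hmem (⟨C, hC⟩, 2), fun h ↦
          h.elim (notMem (by decide) _) (notMem (by decide) _)⟩⟩
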